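/- arXiv:1910.07567 — 3 statements merged into one kernel-verified Lean document; each statement's English description precedes it below -/
import Mathlib

section
/- Let n, C, d be positive integers, z : {1,…,n} → ℝ^d, and for each node i let η(i) ∈ ℝ^C be a probability vector. Let a : {1,…,n} → ℝ^C be prediction-score vectors, and let l : ℝ × {1,…,C} → ℝ satisfy: x ↦ l(x,c) is λ-Lipschitz for each c, and |l(x,c)| ≤ L for all x, c. Let s ⊆ {1,…,n} be a nonempty finite selected set, and let β, γ ≥ 0. Assume: (i) for every j ∈ s, ∑_{c=1}^C η(j)_c · l((a(j))_c, c) = 0; (ii) for all i, j, max_c |(a(i))_c − (a(j))_c| ≤ β · ‖z(i) − z(j)‖₂; (iii) for all i, j, ∑_{c=1}^C |η(i)_c − η(j)_c| ≤ γ · ‖z(i) − z(j)‖₂. Then for every node i, ∑_{c=1}^C η(i)_c · l((a(i))_c, c) ≤ (λβ + Lγ) · min_{j ∈ s} ‖z(i) − z(j)‖₂. -/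
/-- Two weighted losses differ by at most the variation of the scores (averaged over the first weight
vector) plus the loss bound times the `ℓ¹` distance between the weights. -/
theorem sum_mul_le_sum_mul_add {ι : Type*} [Fintype ι] {p q f g : ι → ℝ} {ε L : ℝ}
    (hp0 : ∀ c, 0 ≤ p c) (hp1 : ∑ c, p c = 1)
    (hfg : ∀ c, |f c - g c| ≤ ε) (hg : ∀ c, |g c| ≤ L) :
    ∑ c, p c * f c ≤ ∑ c, q c * g c + (ε + L * ∑ c, |p c - q c|) := by
  have hterm : ∀ c, p c * f c ≤ q c * g c + (p c * ε + L * |p c - q c|) := fun c => by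
    have hf : p c * (f c - g c) ≤ p c * ε :=
      mul_le_mul_of_nonneg_left ((le_abs_self _).trans (hfg c)) (hp0 c)
    have hpq : (p c - q c) * g c ≤ L * |p c - q c| := calc
      (p c - q c) * g c ≤ |g c| * |p c - q c| := by
        rw [mul_comm |g c|, ← abs_mul]; exact le_abs_self _
      _ ≤ L * |p c - q c| := mul_le_mul_of_nonneg_right (hg c) (abs_nonneg _)
    linarith
  calc ∑ c, p c * f c ≤ ∑ c, (q c * g c + (p c * ε + L * |p c - q c|)) :=
        Finset.sum_le_sum fun c _ => hterm c
    _ = ∑ c, q c * g c + (ε + L * ∑ c, |p c - q c|) := by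
        rw [Finset.sum_add_distrib, Finset.sum_add_distrib, ← Finset.sum_mul, hp1, one_mul,
          Finset.mul_sum]


/-- per-node expected-loss bound. Under (i) zero weighted loss on the selected
set `s`, (ii) `β`-Lipschitzness of prediction scores in the propagated features `z`
(in sup-over-classes distance), and (iii) `γ`-Lipschitzness of the label distribution `η`
in total-variation distance, the expected loss at every node `i` is at most
`(λβ + Lγ) · min_{j ∈ s} ‖z i − z j‖₂`. -/
theorem per_node_expected_loss_bound (n C d : ℕ) (hn : 0 < n) (hC : 0 < C) (hd : 0 < d)
    (z : Fin n → EuclideanSpace ℝ (Fin d))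
    (η : Fin n → Fin C → ℝ) (hη0 : ∀ i c, 0 ≤ η i c) (hη1 : ∀ i, ∑ c, η i c = 1)
    (a : Fin n → Fin C → ℝ)
    (l : ℝ → Fin C → ℝ) (lam L : ℝ) (hlam : 0 ≤ lam)
    (hlip : ∀ (c : Fin C) (x y : ℝ), |l x c - l y c| ≤ lam * |x - y|)
    (hbdd : ∀ (x : ℝ) (c : Fin C), |l x c| ≤ L)
    (s : Finset (Fin n)) (hs : s.Nonempty)
    (β γ : ℝ) (hβ : 0 ≤ β) (hγ : 0 ≤ γ)
    (h1 : ∀ j ∈ s, ∑ c, η j c * l (a j c) c = 0)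
    (h2 : ∀ i j : Fin n, (⨆ c, |a i c - a j c|) ≤ β * ‖z i - z j‖)
    (h3 : ∀ i j : Fin n, ∑ c, |η i c - η j c| ≤ γ * ‖z i - z j‖)
    (i : Fin n) :
    ∑ c, η i c * l (a i c) c
      ≤ (lam * β + L * γ) * s.inf' hs (fun j => ‖z i - z j‖) := by
  obtain ⟨j, hj, hmin⟩ := s.exists_mem_eq_inf' hs (fun j => ‖z i - z j‖)
  rw [hmin]
  have hL : 0 ≤ L := (abs_nonneg _).trans (hbdd 0 ⟨0, hC⟩)
  have hscore : ∀ c, |l (a i c) c - l (a j c) c| ≤ lam * (β * ‖z i - z j‖) := fun c =>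
    (hlip c _ _).trans <| mul_le_mul_of_nonneg_left
      ((le_ciSup (f := fun c => |a i c - a j c|) (Set.finite_range _).bddAbove c).trans (h2 i j))
      hlam
  have hloss := sum_mul_le_sum_mul_add (q := η j) (hη0 i) (hη1 i) hscore fun c => hbdd (a j c) c
  rw [h1 j hj] at hloss
  linarith [mul_le_mul_of_nonneg_left (h3 i j) hL]
end

section
/- Let n, C, d be positive integers, z : {1,…,n} → ℝ^d, η(i) ∈ ℝ^C probability vectors, a : {1,…,n} → ℝ^C, l : ℝ × {1,…,C} → ℝ with x ↦ l(x,c) λ-Lipschitz for each c and |l(x,c)| ≤ L, s ⊆ {1,…,n} nonempty, and β, γ ≥ 0, such that: (i) for every j ∈ s, ∑_c η(j)_c · l((a(j))_c, c) = 0; (ii) for all i, j, max_c |(a(i))_c − (a(j))_c| ≤ β · ‖z(i) − z(j)‖₂; (iii) for all i, j, ∑_c |η(i)_c − η(j)_c| ≤ γ · ‖z(i) − z(j)‖₂. Then (1/n) ∑_{i=1}^n ∑_{c=1}^C η(i)_c · l((a(i))_c, c) ≤ ((λβ + Lγ)/n) · ∑_{i=1}^n min_{j ∈ s} ‖z(i)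 − z(j)‖₂. -/
/-- Expected losses under two weight vectors differ by at most the error from moving the scores
plus the error from moving the weights. -/
theorem sum_mul_loss_sub_le {ι : Type*} [Fintype ι] {p q u v : ι → ℝ} {l : ℝ → ι → ℝ}
    {K L δ ε : ℝ} (hK : 0 ≤ K) (hL : 0 ≤ L) (hp0 : ∀ c, 0 ≤ p c) (hp1 : ∑ c, p c = 1)
    (hlip : ∀ c x y, |l x c - l y c| ≤ K * |x - y|) (hbdd : ∀ x c, |l x c| ≤ L)
    (huv : ∀ c, |u c - v c| ≤ δ) (hpq : ∑ c, |p c - q c| ≤ ε) :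
    ∑ c, p c * l (u c) c - ∑ c, q c * l (v c) c ≤ K * δ + L * ε := by
  have scores : ∑ c, p c * (l (u c) c - l (v c) c) ≤ K * δ :=
    calc ∑ c, p c * (l (u c) c - l (v c) c) ≤ ∑ c, p c * (K * δ) := by
          refine Finset.sum_le_sum fun c _ => mul_le_mul_of_nonneg_left ?_ (hp0 c)
          exact (le_abs_self _).trans
            ((hlip c _ _).trans (mul_le_mul_of_nonneg_left (huv c) hK))
      _ = K * δ := by rw [← Finset.sum_mul, hp1, one_mul]
  have weights : ∑ c, (p c - q c) * l (v c) c ≤ L * ε :=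
    calc ∑ c, (p c - q c) * l (v c) c ≤ ∑ c, L * |p c - q c| := by
          refine Finset.sum_le_sum fun c _ => (le_abs_self _).trans ?_
          rw [abs_mul, mul_comm]
          exact mul_le_mul_of_nonneg_right (hbdd _ c) (abs_nonneg _)
      _ ≤ L * ε := by
          rw [← Finset.mul_sum]
          exact mul_le_mul_of_nonneg_left hpq hL
  calc ∑ c, p c * l (u c) c - ∑ c, q c * l (v c) c
      = ∑ c, p c * (l (u c) c - l (v c) c) + ∑ c, (p c - q c) * l (v c) c := by
        rw [← Finset.sum_sub_distrib, ← Finset.sum_add_distrib]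
        exact Finset.sum_congr rfl fun c _ => by ring
    _ ≤ K * δ + L * ε := add_le_add scores weights

/-- deterministic core of Theorem 1 (K-Medoids bound). Under (i) zero weighted
loss on the selected set `s`, (ii) `β`-Lipschitzness of prediction scores in the propagated
features `z`, and (iii) `γ`-Lipschitzness of the label distribution `η`, the average expected
classification loss is bounded by `((λβ + Lγ)/n) · ∑_i min_{j ∈ s} ‖z i − z j‖₂`,
i.e. by a constant times the K-Medoids objective of `s`. -/
theorem average_expected_loss_kmedoids_bound (n C d : ℕ) (hn : 0 < n) (hC : 0 < C) (hd : 0 < d)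
    (z : Fin n → EuclideanSpace ℝ (Fin d))
    (η : Fin n → Fin C → ℝ) (hη0 : ∀ i c, 0 ≤ η i c) (hη1 : ∀ i, ∑ c, η i c = 1)
    (a : Fin n → Fin C → ℝ)
    (l : ℝ → Fin C → ℝ) (lam L : ℝ) (hlam : 0 ≤ lam)
    (hlip : ∀ (c : Fin C) (x y : ℝ), |l x c - l y c| ≤ lam * |x - y|)
    (hbdd : ∀ (x : ℝ) (c : Fin C), |l x c| ≤ L)
    (s : Finset (Fin n)) (hs : s.Nonempty)
    (β γ : ℝ) (hβ : 0 ≤ β) (hγ : 0 ≤ γ)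
    (h1 : ∀ j ∈ s, ∑ c, η j c * l (a j c) c = 0)
    (h2 : ∀ i j : Fin n, (⨆ c, |a i c - a j c|) ≤ β * ‖z i - z j‖)
    (h3 : ∀ i j : Fin n, ∑ c, |η i c - η j c| ≤ γ * ‖z i - z j‖) :
    (1 / n : ℝ) * ∑ i, ∑ c, η i c * l (a i c) c
      ≤ ((lam * β + L * γ) / n) * ∑ i, s.inf' hs (fun j => ‖z i - z j‖) := by
  have hL : 0 ≤ L := (abs_nonneg _).trans (hbdd 0 ⟨0, hC⟩)
  have pointwise (i : Fin n) : ∑ c, η i c * l (a i c) c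
      ≤ (lam * β + L * γ) * s.inf' hs (fun j => ‖z i - z j‖) := by
    obtain ⟨j, hj, hmin⟩ := s.exists_mem_eq_inf' hs (fun j => ‖z i - z j‖)
    have bound := sum_mul_loss_sub_le hlam hL (hη0 i) (hη1 i) hlip hbdd
      (fun c => (le_ciSup (Set.finite_range fun c => |a i c - a j c|).bddAbove c).trans (h2 i j))
      (h3 i j)
    rw [h1 j hj, sub_zero] at bound
    rw [hmin]
    linarith
  calc (1 / n : ℝ) * ∑ i, ∑ c, η i c * l (a i c) c
      ≤ (1 / n : ℝ) * ∑ i, (lam * β + L * γ) * s.inf' hs (fun j => ‖z i - z j‖) :=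
        mul_le_mul_of_nonneg_left (Finset.sum_le_sum fun i _ => pointwise i) (by positivity)
    _ = ((lam * β + L * γ) / n) * ∑ i, s.inf' hs (fun j => ‖z i - z j‖) := by
        rw [← Finset.mul_sum]
        ring
end

section
/- Let n, C, d be positive integers, z : {1,…,n} → ℝ^d, η(i) ∈ ℝ^C probability vectors, a : {1,…,n} → ℝ^C, l : ℝ × {1,…,C} → ℝ with x ↦ l(x,c) λ-Lipschitz for each c and |l(x,c)| ≤ L, s ⊆ {1,…,n} nonempty, and β, γ ≥ 0, such that: (i) for every j ∈ s, ∑_c η(j)_c · l((a(j))_c, c) = 0; (ii) for all i, j, max_c |(a(i))_c − (a(j))_c| ≤ β · ‖z(i) − z(j)‖₂; (iii) for all i, j, ∑_c |η(i)_c − η(j)_c| ≤ γ · ‖z(i) − z(j)‖₂. Then (1/n) ∑_{i=1}^n ∑_{c=1}^C η(i)_c · l((a(i))_c, c) ≤ (λβ + Lγ) · max_{1 ≤ i ≤ n} min_{j ∈ s} ‖z(i) − z(j)‖₂. -/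
/-- deterministic core of Theorem 2 (K-Center / Coreset bound). Under (i) zero
weighted loss on the selected set `s`, (ii) `β`-Lipschitzness of prediction scores in the
propagated features `z`, and (iii) `γ`-Lipschitzness of the label distribution `η`, the
average expected classification loss is bounded by
`(λβ + Lγ) · max_i min_{j ∈ s} ‖z i − z j‖₂`, the K-Center covering radius of `s`. -/
theorem average_expected_loss_kcenter_bound (n C d : ℕ) (hn : 0 < n) (hC : 0 < C) (hd : 0 < d)
    (z : Fin n → EuclideanSpace ℝ (Fin d))
    (η : Fin n → Fin C → ℝ) (hη0 : ∀ i c, 0 ≤ η i c) (hη1 : ∀ i, ∑ c, η i c = 1)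
    (a : Fin n → Fin C → ℝ)
    (l : ℝ → Fin C → ℝ) (lam L : ℝ) (hlam : 0 ≤ lam)
    (hlip : ∀ (c : Fin C) (x y : ℝ), |l x c - l y c| ≤ lam * |x - y|)
    (hbdd : ∀ (x : ℝ) (c : Fin C), |l x c| ≤ L)
    (s : Finset (Fin n)) (hs : s.Nonempty)
    (β γ : ℝ) (hβ : 0 ≤ β) (hγ : 0 ≤ γ)
    (h1 : ∀ j ∈ s, ∑ c, η j c * l (a j c) c = 0)
    (h2 : ∀ i j : Fin n, (⨆ c, |a i c - a j c|) ≤ β * ‖z i - z j‖)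
    (h3 : ∀ i j : Fin n, ∑ c, |η i c - η j c| ≤ γ * ‖z i - z j‖) :
    (1 / n : ℝ) * ∑ i, ∑ c, η i c * l (a i c) c
      ≤ (lam * β + L * γ) * ⨆ i : Fin n, s.inf' hs (fun j => ‖z i - z j‖) := by
  have hL : 0 ≤ L := (abs_nonneg _).trans (hbdd 0 ⟨0, hC⟩)
  have hcoef : 0 ≤ lam * β + L * γ := by positivity
  have pointwise (i j : Fin n) (hj : j ∈ s) :
      ∑ c, η i c * l (a i c) c ≤ (lam * β + L * γ) * ‖z i - z j‖ := by
    have hscore (c : Fin C) : l (a i c) c - l (a j c) c ≤ lam * (β * ‖z i - z j‖) :=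
      (le_abs_self _).trans <| (hlip c _ _).trans <| mul_le_mul_of_nonneg_left
        ((le_ciSup (f := fun c => |a i c - a j c|) (Set.finite_range _).bddAbove c).trans
          (h2 i j)) hlam
    have hlabel (c : Fin C) : (η i c - η j c) * l (a j c) c ≤ |η i c - η j c| * L := by
      refine (le_abs_self _).trans ?_
      rw [abs_mul]
      exact mul_le_mul_of_nonneg_left (hbdd _ _) (abs_nonneg _)
    calc ∑ c, η i c * l (a i c) c
        = ∑ c, η i c * (l (a i c) c - l (a j c) c) + ∑ c, (η i c - η j c) * l (a j c) c
            + ∑ c, η j c * l (a j c) c := by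
          rw [← Finset.sum_add_distrib, ← Finset.sum_add_distrib]
          exact Finset.sum_congr rfl fun c _ => by ring
      _ ≤ ∑ c, η i c * (lam * (β * ‖z i - z j‖)) + ∑ c, |η i c - η j c| * L + 0 := by
          rw [h1 j hj]
          exact add_le_add_left (add_le_add
            (Finset.sum_le_sum fun c _ => mul_le_mul_of_nonneg_left (hscore c) (hη0 i c))
            (Finset.sum_le_sum fun c _ => hlabel c)) 0
      _ = lam * (β * ‖z i - z j‖) + (∑ c, |η i c - η j c|) * L := by
          rw [← Finset.sum_mul, ← Finset.sum_mul, hη1 i, one_mul, add_zero]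
      _ ≤ lam * (β * ‖z i - z j‖) + (γ * ‖z i - z j‖) * L := by
          gcongr
          exact h3 i j
      _ = (lam * β + L * γ) * ‖z i - z j‖ := by ring
  set R := ⨆ i : Fin n, s.inf' hs (fun j => ‖z i - z j‖)
  have hle (i : Fin n) : ∑ c, η i c * l (a i c) c ≤ (lam * β + L * γ) * R := by
    obtain ⟨j, hj, hmin⟩ := s.exists_mem_eq_inf' hs (fun j => ‖z i - z j‖)
    refine (pointwise i j hj).trans (mul_le_mul_of_nonneg_left ?_ hcoef)
    rw [← hmin]
    exact le_ciSup (f := fun i => s.inf' hs (fun j => ‖z i - z j‖))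
      (Set.finite_range _).bddAbove i
  have hn' : (0 : ℝ) < n := Nat.cast_pos.mpr hn
  have hsum := Finset.sum_le_card_nsmul Finset.univ _ _ fun i _ => hle i
  rw [Finset.card_univ, Fintype.card_fin, nsmul_eq_mul] at hsum
  rw [one_div, inv_mul_le_iff₀ hn']
  exact hsum
end
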